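/- arXiv:2210.13057 — 7 statements merged into one kernel-verified Lean document; each statement's English description precedes it below -/
import Mathlib

section
/- Let G be a finite simple graph and let (v_1, ..., v_n) be an ordering of its vertices. For each i let H(v_i) = { x ∈ N(v_i) : x = v_j for some j > i } be the set of higher-ranked neighbors of v_i. Then (v_1, ..., v_n) is a perfect elimination ordering of G if and only if for every i with H(v_i) ≠ ∅, letting u be the vertex of H(v_i) of smallest rank, every vertex of H(v_i) \ {u} is adjacent to u. -/
open SimpleGraph

/-- An ordering `(v 0, …, v (n-1))` of the vertices of `G` is a perfect elimination
ordering if every `v i` is simplicial in `G[{v i, …, v (n-1)}]`, i.e. any two distinct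
higher-ranked neighbours of `v i` are adjacent. -/
def IsPEO {V : Type*} {n : ℕ} (G : SimpleGraph V) (v : Fin n ≃ V) : Prop :=
  ∀ i j k : Fin n, i < j → i < k → j ≠ k →
    G.Adj (v i) (v j) → G.Adj (v i) (v k) → G.Adj (v j) (v k)

/-- An ordering `(v 0, …, v (n-1))` of the vertices of `G` is a perfect elimination
ordering if and only if for every `i` whose set `H(v i)` of higher-ranked neighbours is
nonempty, letting `u = v j` be the member of `H(v i)` of smallest rank, every vertex of
`H(v i) \ {u}` is adjacent to `u`. -/
theorem isPEO_iff_smallest_higher_neighbor_adjacent {V : Type*} {n : ℕ}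
    (G : SimpleGraph V) (v : Fin n ≃ V) :
    IsPEO G v ↔ ∀ i j : Fin n, i < j → G.Adj (v i) (v j) →
      (∀ j' : Fin n, i < j' → j' < j → ¬ G.Adj (v i) (v j')) →
      ∀ k : Fin n, i < k → k ≠ j → G.Adj (v i) (v k) → G.Adj (v j) (v k) := by
  refine ⟨fun h i j hij hj _ k hik hkj hk => h i j k hij hik hkj.symm hj hk, fun h i => ?_⟩
  induction i using WellFoundedGT.induction with
  | ind i ih =>
    intro j k hij hik hjk hj hk
    obtain ⟨u, ⟨hiu, hu⟩, hmin⟩ :=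
      wellFounded_lt.has_min {a : Fin n | i < a ∧ G.Adj (v i) (v a)} ⟨j, hij, hj⟩
    have hadj : ∀ a, i < a → a ≠ u → G.Adj (v i) (v a) → G.Adj (v u) (v a) :=
      h i u hiu hu fun a hia hau ha => hmin a ⟨hia, ha⟩ hau
    have hle : ∀ a, i < a → G.Adj (v i) (v a) → u ≤ a :=
      fun a hia ha => not_lt.1 (hmin a ⟨hia, ha⟩)
    by_cases hju : j = u
    · subst hju
      exact hadj k hik hjk.symm hk
    by_cases hku : k = u
    · subst hku
      exact (hadj j hij hjk hj).symm
    exact ih u hiu j k (lt_of_le_of_ne' (hle j hij hj) hju)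
      (lt_of_le_of_ne' (hle k hik hk) hku) hjk (hadj j hij hju hj) (hadj k hik hku hk)
end

section
/- Let G be a finite simple graph. If some ordering (v_1, ..., v_n) of the vertices of G by non-decreasing degree is not a perfect elimination ordering, then G contains an induced subgraph isomorphic to 2K2, C4, or C5. -/
open SimpleGraph

/-- The graph `2K₂`: four vertices `{0,1,2,3}` with exactly the two edges `0-1` and `2-3`. -/
def twoK2 : SimpleGraph (Fin 4) := SimpleGraph.fromEdgeSet {s(0, 1), s(2, 3)}

/-- `G` contains an induced subgraph isomorphic to `H`. -/
def HasInducedSubgraph {V W : Type*} (G : SimpleGraph V) (H : SimpleGraph W) : Prop :=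
  ∃ s : Set V, Nonempty (G.induce s ≃g H)

/-- An injection of the vertices of `H` into those of `G` that preserves and reflects adjacency
exhibits `H` as an induced subgraph of `G`. -/
lemma HasInducedSubgraph.of_injective {V W : Type*} {G : SimpleGraph V} {H : SimpleGraph W}
    (f : W → V) (hf : f.Injective) (hadj : ∀ i j, G.Adj (f i) (f j) ↔ H.Adj i j) :
    HasInducedSubgraph G H :=
  ⟨Set.range f, ⟨RelIso.symm ⟨Equiv.ofInjective f hf, by simp [hadj]⟩⟩⟩

/-- If `x` is adjacent to `z` but `y` is not, and `deg x ≤ deg y`, then `y` has a neighbour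
outside the closed neighbourhood of `x`. -/
lemma SimpleGraph.exists_adj_not_adj_of_degree_le {V : Type*} [Fintype V] [DecidableEq V]
    (G : SimpleGraph V) [DecidableRel G.Adj] {x y z : V} (hxy : G.Adj x y) (hxz : G.Adj x z)
    (hyz : ¬ G.Adj y z) (hne : y ≠ z) (hle : G.degree x ≤ G.degree y) :
    ∃ a, G.Adj y a ∧ ¬ G.Adj x a ∧ a ≠ x := by
  by_contra! h
  have hsub : (G.neighborFinset y).erase x ⊆ ((G.neighborFinset x).erase y).erase z := by
    intro a ha
    simp only [Finset.mem_erase, mem_neighborFinset] at ha ⊢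
    refine ⟨?_, ha.2.ne', ?_⟩
    · rintro rfl
      exact hyz ha.2
    · by_contra hxa
      exact ha.1 (h a ha.2 hxa)
  have hcard := Finset.card_le_card hsub
  have hz : z ∈ (G.neighborFinset x).erase y := by simp [hxz, hne.symm]
  have hlt := Finset.card_erase_lt_of_mem hz
  rw [Finset.card_erase_of_mem (by simp [hxy.symm]), card_neighborFinset_eq_degree] at hcard
  rw [Finset.card_erase_of_mem (a := y) (by simp [hxy]), card_neighborFinset_eq_degree] at hlt
  omega

lemma hasInducedSubgraph_twoK2 {V : Type*} {G : SimpleGraph V} {a b c d : V}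
    (hab : G.Adj a b) (hcd : G.Adj c d) (hac : ¬ G.Adj a c) (had : ¬ G.Adj a d)
    (hbc : ¬ G.Adj b c) (hbd : ¬ G.Adj b d) : HasInducedSubgraph G twoK2 := by
  have hac' : a ≠ c := fun h => had (h ▸ hcd)
  have had' : a ≠ d := fun h => hac (h ▸ hcd.symm)
  have hbc' : b ≠ c := fun h => hbd (h ▸ hcd)
  have hbd' : b ≠ d := fun h => hbc (h ▸ hcd.symm)
  refine .of_injective ![a, b, c, d] ?_ ?_
  · intro i j
    fin_cases i <;> fin_cases j <;> simp [hab.ne, hcd.ne, hab.ne', hcd.ne', hac', had', hbc', hbd',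
      hac'.symm, had'.symm, hbc'.symm, hbd'.symm]
  · intro i j
    fin_cases i <;> fin_cases j <;> simp [twoK2, hab, hcd, hac, had, hbc, hbd, G.adj_comm b a,
      G.adj_comm c a, G.adj_comm d a, G.adj_comm c b, G.adj_comm d b, G.adj_comm d c]

lemma hasInducedSubgraph_cycleGraph_four {V : Type*} {G : SimpleGraph V} {a b c d : V}
    (hab : G.Adj a b) (hbc : G.Adj b c) (hcd : G.Adj c d) (had : G.Adj a d)
    (hac : ¬ G.Adj a c) (hbd : ¬ G.Adj b d) (hac' : a ≠ c) (hbd' : b ≠ d) :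
    HasInducedSubgraph G (cycleGraph 4) := by
  refine .of_injective ![a, b, c, d] ?_ ?_
  · intro i j
    fin_cases i <;> fin_cases j <;> simp [hab.ne, hcd.ne, hab.ne', hcd.ne', hbc.ne, hbc.ne',
      had.ne, had.ne', hac', hbd', hac'.symm, hbd'.symm]
  · intro i j
    fin_cases i <;> fin_cases j <;> simp [cycleGraph_adj, hab, hcd, hac, had, hbc, hbd,
      G.adj_comm b a, G.adj_comm c a, G.adj_comm d a, G.adj_comm c b, G.adj_comm d b,
      G.adj_comm d c] <;> decide

lemma hasInducedSubgraph_cycleGraph_five {V : Type*} {G : SimpleGraph V} {a b c d e : V}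
    (hab : G.Adj a b) (hbc : G.Adj b c) (hcd : G.Adj c d) (hde : G.Adj d e) (hae : G.Adj a e)
    (hac : ¬ G.Adj a c) (had : ¬ G.Adj a d) (hbd : ¬ G.Adj b d) (hbe : ¬ G.Adj b e)
    (hce : ¬ G.Adj c e) : HasInducedSubgraph G (cycleGraph 5) := by
  have hac' : a ≠ c := fun h => had (h ▸ hcd)
  have had' : a ≠ d := fun h => hac (h ▸ hcd.symm)
  have hbd' : b ≠ d := fun h => hbe (h ▸ hde)
  have hbe' : b ≠ e := fun h => hbd (h ▸ hde.symm)
  have hce' : c ≠ e := fun h => hac (h ▸ hae)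
  refine .of_injective ![a, b, c, d, e] ?_ ?_
  · intro i j
    fin_cases i <;> fin_cases j <;> simp [hab.ne, hcd.ne, hab.ne', hcd.ne', hbc.ne, hbc.ne',
      hde.ne, hde.ne', hae.ne, hae.ne', hac', had', hbd', hbe', hce',
      hac'.symm, had'.symm, hbd'.symm, hbe'.symm, hce'.symm]
  · intro i j
    fin_cases i <;> fin_cases j <;> simp [cycleGraph_adj, hab, hcd, hac, had, hbc, hbd, hde, hae,
      hbe, hce, G.adj_comm b a, G.adj_comm c a, G.adj_comm d a, G.adj_comm c b, G.adj_comm d b,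
      G.adj_comm d c, G.adj_comm e a, G.adj_comm e b, G.adj_comm e c, G.adj_comm e d] <;> decide

/-- If some ordering of the vertices of `G` by non-decreasing degree is not a perfect
elimination ordering, then `G` contains an induced subgraph isomorphic to `2K₂`, `C₄`,
or `C₅`. -/
theorem not_isPEO_nondecreasing_degree_ordering_imp_forbidden {V : Type*} [Fintype V]
    [DecidableEq V] (G : SimpleGraph V) [DecidableRel G.Adj]
    (v : Fin (Fintype.card V) ≃ V)
    (hdeg : ∀ i j : Fin (Fintype.card V), i ≤ j → G.degree (v i) ≤ G.degree (v j))
    (hnot : ¬ IsPEO G v) :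
    HasInducedSubgraph G twoK2 ∨ HasInducedSubgraph G (cycleGraph 4) ∨
      HasInducedSubgraph G (cycleGraph 5) := by
  unfold IsPEO at hnot
  push Not at hnot
  obtain ⟨i, j, k, hij, hik, hjk, hxy, hxz, hyz⟩ := hnot
  have hne : v j ≠ v k := v.injective.ne hjk
  have hzy : ¬ G.Adj (v k) (v j) := fun h => hyz h.symm
  obtain ⟨a, hya, hxa, hax⟩ :=
    G.exists_adj_not_adj_of_degree_le hxy hxz hyz hne (hdeg i j hij.le)
  obtain ⟨b, hzb, hxb, hbx⟩ :=
    G.exists_adj_not_adj_of_degree_le hxz hxy hzy hne.symm (hdeg i k hik.le)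
  by_cases haz : G.Adj a (v k)
  · exact .inr (.inl (hasInducedSubgraph_cycleGraph_four hxy hya haz hxz hxa hyz hax.symm hne))
  by_cases hby : G.Adj b (v j)
  · exact .inr (.inl
      (hasInducedSubgraph_cycleGraph_four hxz hzb hby hxy hxb hzy hbx.symm hne.symm))
  have hyb : ¬ G.Adj (v j) b := fun h => hby h.symm
  by_cases hab : G.Adj a b
  · exact .inr (.inr (hasInducedSubgraph_cycleGraph_five hxy hya hab hzb.symm hxz
      hxa hxb hyb hyz haz))
  · exact .inl (hasInducedSubgraph_twoK2 hya hzb hyz hyb haz hab)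
end

section
/- Let G be a finite simple graph with at least one vertex and let (v_1, ..., v_n) be a perfect elimination ordering of G. For each i let H(v_i) = { x ∈ N(v_i) : x = v_j for some j > i }. Then the clique number of G equals 1 + max_{1 ≤ i ≤ n} |H(v_i)|. -/
open SimpleGraph

namespace IsPEO

variable {V : Type*} {n : ℕ} {G : SimpleGraph V} [DecidableRel G.Adj] {v : Fin n ≃ V}

/-- A vertex together with its higher-ranked neighbours forms a clique. -/
theorem isNClique_insert_higher_neighbors (hpeo : IsPEO G v) (i : Fin n) [DecidableEq V] :
    G.IsNClique ((Finset.univ.filter fun j => i < j ∧ G.Adj (v i) (v j)).card + 1)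
      (insert (v i)
        ((Finset.univ.filter fun j => i < j ∧ G.Adj (v i) (v j)).map v.toEmbedding)) := by
  refine IsNClique.insert ⟨?_, Finset.card_map _⟩ ?_
  · intro x hx y hy hxy
    simp only [Finset.coe_map, Set.mem_image, Finset.mem_coe, Finset.mem_filter,
      Finset.mem_univ, true_and, Equiv.coe_toEmbedding] at hx hy
    obtain ⟨j, ⟨hij, haj⟩, rfl⟩ := hx
    obtain ⟨k, ⟨hik, hak⟩, rfl⟩ := hy
    exact hpeo i j k hij hik (fun h => hxy (congrArg v h)) haj hak
  · intro x hx
    obtain ⟨j, hj, rfl⟩ := Finset.mem_map.1 hx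
    exact (Finset.mem_filter.1 hj).2.2

end IsPEO

/-- In any vertex ordering, a nonempty clique consists of its lowest-ranked vertex and some of the
higher-ranked neighbours of that vertex. -/
theorem SimpleGraph.IsClique.exists_card_le_card_higher_neighbors {V : Type*} {n : ℕ}
    {G : SimpleGraph V} [DecidableRel G.Adj] {s : Finset V} (hs : G.IsClique (s : Set V))
    (hne : s.Nonempty) (v : Fin n ≃ V) :
    ∃ i, s.card ≤ 1 + (Finset.univ.filter fun j => i < j ∧ G.Adj (v i) (v j)).card := by
  classical
  obtain ⟨i, hi, hmin⟩ := (s.map v.symm.toEmbedding).exists_min_image id (hne.map)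
  have hmem : ∀ j ∈ s.map v.symm.toEmbedding, v j ∈ s := fun j hj => by
    simpa [Finset.mem_map_equiv] using hj
  refine ⟨i, ?_⟩
  rw [← Finset.card_map v.symm.toEmbedding, ← Finset.card_erase_add_one hi, add_comm]
  gcongr
  intro j hj
  obtain ⟨hji, hj⟩ := Finset.mem_erase.1 hj
  exact Finset.mem_filter.2 ⟨Finset.mem_univ j, lt_of_le_of_ne (hmin j hj) hji.symm,
    hs (hmem i hi) (hmem j hj) (v.injective.ne hji.symm)⟩

/-- For a finite graph `G` with at least one vertex and a perfect elimination ordering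
`(v 0, …, v (n-1))` of `G`, the clique number of `G` equals
`1 + max_i |H(v i)|`, where `H(v i)` is the set of higher-ranked neighbours of `v i`. -/
theorem cliqueNum_eq_one_add_max_card_higher_neighbors {V : Type*} [Fintype V] [Nonempty V]
    [DecidableEq V] (G : SimpleGraph V) [DecidableRel G.Adj]
    (v : Fin (Fintype.card V) ≃ V) (hpeo : IsPEO G v) :
    G.cliqueNum = 1 + Finset.univ.sup (fun i : Fin (Fintype.card V) =>
      (Finset.univ.filter (fun j : Fin (Fintype.card V) => i < j ∧ G.Adj (v i) (v j))).card) := by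
  apply le_antisymm
  · obtain ⟨s, hs⟩ := G.exists_isNClique_cliqueNum
    rw [← hs.card_eq]
    rcases s.eq_empty_or_nonempty with rfl | hne
    · simp
    obtain ⟨i, hi⟩ := hs.isClique.exists_card_le_card_higher_neighbors hne v
    exact hi.trans (Nat.add_le_add_left (Finset.le_sup (f := fun i =>
      (Finset.univ.filter fun j => i < j ∧ G.Adj (v i) (v j)).card) (Finset.mem_univ i)) 1)
  · have : Nonempty (Fin (Fintype.card V)) := v.nonempty
    obtain ⟨i, -, hi⟩ := Finset.exists_mem_eq_sup Finset.univ Finset.univ_nonempty fun i =>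
      (Finset.univ.filter fun j => i < j ∧ G.Adj (v i) (v j)).card
    have hclique := hpeo.isNClique_insert_higher_neighbors i
    rw [hi, add_comm, ← hclique.card_eq]
    exact hclique.isClique.card_le_cliqueNum
end

section
/- A finite simple graph G contains no induced subgraph isomorphic to 2K2, P4, or C4 if and only if every nonempty induced subgraph of G contains a vertex that is isolated or universal in that induced subgraph. Equivalently, G is a threshold graph if and only if repeatedly removing isolated and universal vertices from G results in the empty graph. -/
open SimpleGraph

/-- `G` is a threshold graph: it has no induced subgraph isomorphic to `2K₂`, `P₄`
or `C₄`. -/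
def IsThreshold {V : Type*} (G : SimpleGraph V) : Prop :=
  ¬ HasInducedSubgraph G twoK2 ∧ ¬ HasInducedSubgraph G (pathGraph 4) ∧
    ¬ HasInducedSubgraph G (cycleGraph 4)

theorem HasInducedSubgraph.of_adj_iff {V W : Type*} {G : SimpleGraph V} {H : SimpleGraph W}
    (f : W → V) (hf : Function.Injective f) (h : ∀ i j, G.Adj (f i) (f j) ↔ H.Adj i j) :
    HasInducedSubgraph G H :=
  ⟨Set.range f, ⟨(Embedding.isoInduceRange ⟨⟨f, hf⟩, h _ _⟩).symm⟩⟩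

theorem twoK2_adj_iff (i j : Fin 4) :
    twoK2.Adj i j ↔ (i = 0 ∧ j = 1 ∨ i = 1 ∧ j = 0) ∨ (i = 2 ∧ j = 3 ∨ i = 3 ∧ j = 2) := by
  fin_cases i <;> fin_cases j <;> simp [twoK2]

/-- A threshold graph has no alternating 4-cycle. -/
theorem IsThreshold.adj_of_adj_of_adj {V : Type*} {G : SimpleGraph V} (hG : IsThreshold G)
    {a b c d : V} (hab : G.Adj a b) (hcd : G.Adj c d) (hac : ¬ G.Adj a c) (nac : a ≠ c)
    (nbd : b ≠ d) : G.Adj b d := by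
  by_contra hbd
  obtain ⟨hK, hP, hC⟩ := hG
  have nab := hab.ne
  have ncd := hcd.ne
  have nad : a ≠ d := by rintro rfl; exact hac hcd.symm
  have nbc : b ≠ c := by rintro rfl; exact hac hab
  have inj : Function.Injective ![a, b, c, d] := by
    intro i j
    fin_cases i <;> fin_cases j <;> simp [*, eq_comm]
  have inj' : Function.Injective ![b, a, d, c] := by
    intro i j
    fin_cases i <;> fin_cases j <;> simp [*, eq_comm]
  by_cases had : G.Adj a d <;> by_cases hbc : G.Adj b c
  · refine hC (.of_adj_iff _ inj fun i j => ?_)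
    rw [cycleGraph_adj]
    fin_cases i <;> fin_cases j <;> simp [*, G.adj_comm] <;> decide
  · refine hP (.of_adj_iff _ inj' fun i j => ?_)
    rw [pathGraph_adj]
    fin_cases i <;> fin_cases j <;> simp [*, G.adj_comm]
  · refine hP (.of_adj_iff _ inj fun i j => ?_)
    rw [pathGraph_adj]
    fin_cases i <;> fin_cases j <;> simp [*, G.adj_comm]
  · refine hK (.of_adj_iff _ inj fun i j => ?_)
    rw [twoK2_adj_iff]
    fin_cases i <;> fin_cases j <;> simp [*, G.adj_comm]

theorem IsThreshold.exists_isolated_or_universal {V : Type*} [Fintype V] {G : SimpleGraph V}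
    (hG : IsThreshold G) {s : Set V} (hs : s.Nonempty) :
    ∃ x ∈ s, (∀ y ∈ s, ¬ G.Adj x y) ∨ (∀ y ∈ s, y ≠ x → G.Adj x y) := by
  classical
  let N (v : V) : Finset V := {w | w ∈ s ∧ G.Adj v w}
  have hN (v w : V) : w ∈ N v ↔ w ∈ s ∧ G.Adj v w := by simp [N]
  obtain ⟨x, hx, hmax⟩ := s.toFinite.exists_maximalFor (fun v => (N v).card) s hs
  by_cases hu : ∀ y ∈ s, y ≠ x → G.Adj x y
  · exact ⟨x, hx, .inr hu⟩
  push Not at hu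
  obtain ⟨y, hy, hyx, hxy⟩ := hu
  refine ⟨y, hy, .inl fun z hz hyz => ?_⟩
  have hle : (N z).card ≤ (N x).card := by
    by_contra! hlt
    exact hlt.not_ge (hmax hz hlt.le)
  have hsub : (N x).erase z ⊂ (N z).erase x := by
    rw [Finset.ssubset_iff_of_subset]
    · exact ⟨y, by simp [hN, hy, hyx, hyz.symm], by simp [hN, hxy]⟩
    · intro w hw
      simp only [Finset.mem_erase, hN] at hw ⊢
      exact ⟨hw.2.2.ne', hw.2.1,
        (hG.adj_of_adj_of_adj hw.2.2 hyz hxy hyx.symm hw.1).symm⟩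
  have hcard := Finset.card_lt_card hsub
  by_cases hxz : G.Adj x z
  · rw [Finset.card_erase_of_mem ((hN x z).2 ⟨hz, hxz⟩),
      Finset.card_erase_of_mem ((hN z x).2 ⟨hx, hxz.symm⟩)] at hcard
    omega
  · rw [Finset.erase_eq_of_notMem fun h => hxz ((hN x z).1 h).2,
      Finset.erase_eq_of_notMem fun h => hxz ((hN z x).1 h).2.symm] at hcard
    omega

theorem not_hasInducedSubgraph_of_exists_isolated_or_universal {V W : Type*} [Nonempty W]
    {G : SimpleGraph V} {H : SimpleGraph W}
    (hG : ∀ s : Set V, s.Nonempty → ∃ x ∈ s,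
      (∀ y ∈ s, ¬ G.Adj x y) ∨ (∀ y ∈ s, y ≠ x → G.Adj x y))
    (hH : ∀ i, (∃ j, H.Adj i j) ∧ ∃ j, j ≠ i ∧ ¬ H.Adj i j) : ¬ HasInducedSubgraph G H := by
  rintro ⟨s, ⟨e⟩⟩
  obtain ⟨x, hx, h⟩ := hG s ⟨_, (e.symm (Classical.arbitrary W)).2⟩
  obtain ⟨i, hi⟩ := e.symm.surjective ⟨x, hx⟩
  obtain rfl : (e.symm i : V) = x := congrArg Subtype.val hi
  obtain ⟨⟨j, hij⟩, k, hki, hik⟩ := hH i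
  rcases h with h | h
  · exact h _ (e.symm j).2 (e.symm.map_adj_iff.2 hij)
  · exact hik (e.symm.map_adj_iff.1
      (h _ (e.symm k).2 fun hk => hki (e.symm.injective (Subtype.ext hk))))

/-- A finite simple graph `G` contains no induced subgraph isomorphic to `2K₂`, `P₄` or
`C₄` (i.e. `G` is a threshold graph) if and only if every nonempty induced subgraph of
`G` contains a vertex that is isolated or universal in that induced subgraph. -/
theorem isThreshold_iff_every_induced_subgraph_has_isolated_or_universal {V : Type*}
    [Fintype V] (G : SimpleGraph V) :
    IsThreshold G ↔ ∀ s : Set V, s.Nonempty → ∃ x ∈ s,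
      (∀ y ∈ s, ¬ G.Adj x y) ∨ (∀ y ∈ s, y ≠ x → G.Adj x y) := by
  refine ⟨fun hG s hs => hG.exists_isolated_or_universal hs, fun hG => ⟨?_, ?_, ?_⟩⟩ <;>
    refine not_hasInducedSubgraph_of_exists_isolated_or_universal hG ?_
  · simp only [twoK2_adj_iff]
    decide
  · simp only [pathGraph_adj]
    decide
  · simp only [cycleGraph_adj]
    decide
end

section
/- A finite simple graph G on n vertices is a threshold graph if and only if there is an ordering (v_1, ..., v_n) of its vertices such that for every i, the vertex v_i is either isolated or universal in the induced subgraph G[{v_1, ..., v_i}]. -/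
open SimpleGraph

theorem hasInducedSubgraph_iff_exists_injective {V W : Type*} {G : SimpleGraph V}
    {H : SimpleGraph W} :
    HasInducedSubgraph G H ↔
      ∃ f : W → V, Function.Injective f ∧ ∀ i j, G.Adj (f i) (f j) ↔ H.Adj i j := by
  constructor
  · rintro ⟨s, ⟨e⟩⟩
    exact ⟨fun i => (e.symm i : V), Subtype.val_injective.comp e.symm.injective,
      fun i j => e.symm.map_adj_iff⟩
  · rintro ⟨f, hf, h⟩
    refine ⟨Set.range f, ⟨RelIso.symm ⟨Equiv.ofInjective f hf, ?_⟩⟩⟩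
    intro i j
    exact h i j

/-- `G` has no alternating four-cycle: there are no edges `ab`, `cd` such that `ac`, `bd` are
pairs of distinct non-adjacent vertices. -/
def NoAlternatingFourCycle {V : Type*} (G : SimpleGraph V) : Prop :=
  ∀ ⦃a b c d : V⦄, G.Adj a b → G.Adj c d → a ≠ c → b ≠ d → ¬ G.Adj a c → G.Adj b d

theorem NoAlternatingFourCycle.not_hasInducedSubgraph {V : Type*} {G : SimpleGraph V}
    (hG : NoAlternatingFourCycle G) {H : SimpleGraph (Fin 4)} (h01 : H.Adj 0 1)
    (h23 : H.Adj 2 3) (h02 : ¬ H.Adj 0 2) (h13 : ¬ H.Adj 1 3) : ¬ HasInducedSubgraph G H := by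
  rw [hasInducedSubgraph_iff_exists_injective]
  rintro ⟨f, hf, h⟩
  exact h13 ((h 1 3).1 (hG ((h 0 1).2 h01) ((h 2 3).2 h23) (hf.ne (by decide))
    (hf.ne (by decide)) (mt (h 0 2).1 h02)))

theorem hasInducedSubgraph_of_adj_iff {V : Type*} {G : SimpleGraph V} {H : SimpleGraph (Fin 4)}
    {a b c d : V} (hab : a ≠ b) (hac : a ≠ c) (had : a ≠ d) (hbc : b ≠ c) (hbd : b ≠ d)
    (hcd : c ≠ d) (h01 : G.Adj a b ↔ H.Adj 0 1) (h02 : G.Adj a c ↔ H.Adj 0 2)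
    (h03 : G.Adj a d ↔ H.Adj 0 3) (h12 : G.Adj b c ↔ H.Adj 1 2)
    (h13 : G.Adj b d ↔ H.Adj 1 3) (h23 : G.Adj c d ↔ H.Adj 2 3) : HasInducedSubgraph G H := by
  refine hasInducedSubgraph_iff_exists_injective.2 ⟨![a, b, c, d], ?_, ?_⟩
  · intro i j
    fin_cases i <;> fin_cases j <;> simp [*, Ne.symm, eq_comm]
  · intro i j
    fin_cases i <;> fin_cases j <;> simp <;> grind [SimpleGraph.adj_comm]

theorem isThreshold_iff_noAlternatingFourCycle {V : Type*} {G : SimpleGraph V} :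
    IsThreshold G ↔ NoAlternatingFourCycle G := by
  constructor
  · rintro ⟨hK, hP4, hC4⟩ a b c d hab hcd hac hbd nac
    by_contra nbd
    have had : a ≠ d := by rintro rfl; exact nac hcd.symm
    have hbc : b ≠ c := by rintro rfl; exact nac hab
    by_cases h03 : G.Adj a d <;> by_cases h12 : G.Adj b c
    · refine hC4 (hasInducedSubgraph_of_adj_iff hab.ne hac had hbc hbd hcd.ne ?_ ?_ ?_ ?_ ?_ ?_) <;>
        simp only [*, true_iff, false_iff] <;> decide
    · refine hP4 (hasInducedSubgraph_of_adj_iff hab.ne' hbd hbc had hac hcd.ne' ?_ ?_ ?_ ?_ ?_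
        ?_) <;>
        simp [*, hab.symm, hcd.symm, pathGraph_adj]
    · refine hP4 (hasInducedSubgraph_of_adj_iff hab.ne hac had hbc hbd hcd.ne ?_ ?_ ?_ ?_ ?_ ?_) <;>
        simp [*, pathGraph_adj]
    · refine hK (hasInducedSubgraph_of_adj_iff hab.ne hac had hbc hbd hcd.ne ?_ ?_ ?_ ?_ ?_ ?_) <;>
        simp [*, twoK2]
  · intro hG
    refine ⟨hG.not_hasInducedSubgraph ?_ ?_ ?_ ?_, hG.not_hasInducedSubgraph ?_ ?_ ?_ ?_,
      hG.not_hasInducedSubgraph ?_ ?_ ?_ ?_⟩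
    iterate 4 simp [twoK2]
    iterate 4 simp [pathGraph_adj]
    all_goals decide

theorem NoAlternatingFourCycle.exists_isolated_or_universal {V : Type*} {G : SimpleGraph V}
    (hG : NoAlternatingFourCycle G) {S : Finset V} (hS : S.Nonempty) :
    ∃ v ∈ S, (∀ w ∈ S, w ≠ v → ¬ G.Adj v w) ∨ (∀ w ∈ S, w ≠ v → G.Adj v w) := by
  classical
  obtain ⟨v, hv, hmax⟩ := S.exists_max_image (fun v => (S.filter (G.Adj v)).card) hS
  by_cases huniv : ∀ w ∈ S, w ≠ v → G.Adj v w
  · exact ⟨v, hv, Or.inr huniv⟩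
  push Not at huniv
  obtain ⟨w, hw, hwv, nvw⟩ := huniv
  refine ⟨w, hw, Or.inl fun x hx _ hwx => (hmax x hx).not_gt ?_⟩
  have hN : ∀ u, G.Adj v u → u ≠ x → G.Adj x u := fun u hu hux =>
    (hG hu hwx hwv.symm hux nvw).symm
  by_cases hvx : G.Adj v x
  · have hsub : insert v (insert w ((S.filter (G.Adj v)).erase x)) ⊆ S.filter (G.Adj x) := by
      intro u hu
      simp only [Finset.mem_insert, Finset.mem_erase, Finset.mem_filter] at hu ⊢
      rcases hu with rfl | rfl | ⟨hux, huS, hvu⟩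
      · exact ⟨hv, hvx.symm⟩
      · exact ⟨hw, hwx.symm⟩
      · exact ⟨huS, hN u hvu hux⟩
    have hcard := Finset.card_le_card hsub
    rw [Finset.card_insert_of_notMem (by simp [hwv.symm]),
      Finset.card_insert_of_notMem (by simp [nvw]),
      Finset.card_erase_of_mem (by simp [hx, hvx])] at hcard
    omega
  · refine Finset.card_lt_card (Finset.ssubset_iff.2 ⟨w, by simp [nvw], ?_⟩)
    intro u hu
    simp only [Finset.mem_insert, Finset.mem_filter] at hu ⊢
    rcases hu with rfl | ⟨huS, hvu⟩
    · exact ⟨hw, hwx.symm⟩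
    · exact ⟨huS, hN u hvu (by rintro rfl; exact hvx hvu)⟩

theorem NoAlternatingFourCycle.exists_sequence {V : Type*} [Nonempty V] {G : SimpleGraph V}
    (hG : NoAlternatingFourCycle G) (n : ℕ) (S : Finset V) (hS : S.card = n) :
    ∃ f : ℕ → V, (∀ i < n, f i ∈ S) ∧ (∀ i < n, ∀ j < i, f i ≠ f j) ∧
      ∀ i < n, (∀ j < i, ¬ G.Adj (f i) (f j)) ∨ (∀ j < i, G.Adj (f i) (f j)) := by
  classical
  induction n generalizing S with
  | zero => exact ⟨fun _ => Classical.arbitrary V, by simp⟩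
  | succ n ih =>
    obtain ⟨v, hv, h⟩ := hG.exists_isolated_or_universal
      (Finset.card_pos.1 (by omega : 0 < S.card))
    obtain ⟨f, hfS, hinj, hf⟩ := ih (S.erase v) (by rw [Finset.card_erase_of_mem hv]; omega)
    simp only [Finset.mem_erase] at hfS
    refine ⟨fun i => if i < n then f i else v, ?_, ?_, ?_⟩ <;> grind

theorem noAlternatingFourCycle_of_ordering {V : Type*} {G : SimpleGraph V}
    (r : V → ℕ) (hr : Function.Injective r)
    (h : ∀ x, (∀ y, r y < r x → ¬ G.Adj x y) ∨ (∀ y, r y < r x → G.Adj x y)) :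
    NoAlternatingFourCycle G := by
  intro a b c d hab hcd hac hbd nac
  by_contra nbd
  have had : a ≠ d := by rintro rfl; exact nac hcd.symm
  have hbc : b ≠ c := by rintro rfl; exact nac hab
  have key : ∀ x y z, G.Adj x y → ¬ G.Adj x z → r y < r x → ¬ r z < r x := by
    intro x y z hxy nxz hy hz
    rcases h x with h | h
    · exact h y hy hxy
    · exact nxz (h z hz)
  have ha := key a b c hab nac
  have hb := key b a d hab.symm nbd
  have hc := key c d a hcd (fun h => nac h.symm)
  have hd := key d c b hcd.symm (fun h => nbd h.symm)
  have := hr.ne hab.ne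
  have := hr.ne hcd.ne
  have := hr.ne hac
  have := hr.ne hbd
  have := hr.ne had
  have := hr.ne hbc
  omega

/-- A finite simple graph `G` on `n` vertices is a threshold graph if and only if there
is an ordering `(v 0, …, v (n-1))` of its vertices such that each `v i` is isolated or
universal in the induced subgraph `G[{v 0, …, v i}]`. -/
theorem isThreshold_iff_exists_construction_ordering {V : Type*} [Fintype V]
    (G : SimpleGraph V) :
    IsThreshold G ↔ ∃ v : Fin (Fintype.card V) ≃ V,
      ∀ i : Fin (Fintype.card V),
        (∀ j : Fin (Fintype.card V), j < i → ¬ G.Adj (v i) (v j)) ∨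
        (∀ j : Fin (Fintype.card V), j < i → G.Adj (v i) (v j)) := by
  rw [isThreshold_iff_noAlternatingFourCycle]
  constructor
  · intro hG
    rcases isEmpty_or_nonempty V with hV | hV
    · exact ⟨(Fintype.equivFin V).symm, fun i => isEmptyElim ((Fintype.equivFin V).symm i)⟩
    obtain ⟨f, -, hinj, hf⟩ := hG.exists_sequence (Fintype.card V) Finset.univ rfl
    have hbij : Function.Bijective fun i : Fin (Fintype.card V) => f i := by
      refine (Fintype.bijective_iff_injective_and_card _).2 ⟨fun i j hij => ?_, by simp⟩
      rcases lt_trichotomy i j with h | h | h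
      · exact absurd hij.symm (hinj j j.2 i h)
      · exact h
      · exact absurd hij (hinj i i.2 j h)
    exact ⟨Equiv.ofBijective _ hbij, fun i =>
      (hf i i.2).imp (fun h j hj => h j hj) (fun h j hj => h j hj)⟩
  · rintro ⟨v, hv⟩
    refine noAlternatingFourCycle_of_ordering (fun x => v.symm x)
      (Fin.val_injective.comp v.symm.injective) fun x => ?_
    exact (hv (v.symm x)).imp (fun h y hy => by simpa using h (v.symm y) hy)
      (fun h y hy => by simpa using h (v.symm y) hy)
end

section
/- Let G be a finite simple graph and let γ = (v_1, ..., v_n) be any ordering of its vertices by non-increasing degree (deg(v_1) ≥ deg(v_2) ≥ ... ≥ deg(v_n)). Then γ is a universal-in-a-component ordering of G if and only if G is trivially perfect, i.e., G contains no induced subgraph isomorphic to P4 or C4. -/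
open SimpleGraph

/-- An ordering `(v 0, …, v (n-1))` of the vertices of `G` is a
universal-in-a-component ordering if every `v i` is universal in its connected component
of `G[{v i, …, v (n-1)}]`, i.e. `v i` is adjacent to every other vertex of
`G[{v i, …, v (n-1)}]` that is reachable from it. -/
def IsUCO {V : Type*} {n : ℕ} (G : SimpleGraph V) (v : Fin n ≃ V) : Prop :=
  ∀ i j : Fin n, ∀ hij : i < j,
    (G.induce {x | ∃ k, i ≤ k ∧ v k = x}).Reachable
      ⟨v i, i, le_rfl, rfl⟩ ⟨v j, j, hij.le, rfl⟩ →
    G.Adj (v i) (v j)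

lemma hasInducedSubgraph_iff_nonempty_embedding {V W : Type*} {G : SimpleGraph V}
    {H : SimpleGraph W} : HasInducedSubgraph G H ↔ Nonempty (H ↪g G) := by
  constructor
  · rintro ⟨s, ⟨e⟩⟩
    exact ⟨(Embedding.induce s).comp e.symm.toEmbedding⟩
  · rintro ⟨f⟩
    refine ⟨Set.range f, ⟨RelIso.symm ⟨Equiv.ofInjective f f.injective, ?_⟩⟩⟩
    intro a b
    exact f.map_adj_iff

/-- A graph has an induced `P₄` or `C₄` iff it has a path `a b c d` in which neither `a, c` nor
`b, d` are adjacent. -/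
lemma hasInducedSubgraph_path_or_cycle_four_iff {V : Type*} {G : SimpleGraph V} :
    HasInducedSubgraph G (pathGraph 4) ∨ HasInducedSubgraph G (cycleGraph 4) ↔
      ∃ a b c d, G.Adj a b ∧ G.Adj b c ∧ G.Adj c d ∧ a ≠ c ∧ b ≠ d ∧
        ¬ G.Adj a c ∧ ¬ G.Adj b d := by
  simp only [hasInducedSubgraph_iff_nonempty_embedding]
  constructor
  · rintro (⟨⟨f⟩⟩ | ⟨⟨f⟩⟩) <;>
    · refine ⟨f 0, f 1, f 2, f 3, ?_⟩
      simp only [f.map_adj_iff, ne_eq, f.injective.eq_iff, pathGraph_adj, cycleGraph_adj]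
      decide
  · rintro ⟨a, b, c, d, hab, hbc, hcd, hac, hbd, hac', hbd'⟩
    have had : a ≠ d := by
      rintro rfl
      exact hac' hcd.symm
    have hinj : Function.Injective ![a, b, c, d] := by
      intro i j hij
      have := hab.ne
      have := hbc.ne
      have := hcd.ne
      fin_cases i <;> fin_cases j <;> simp_all
    by_cases h : G.Adj a d
    · refine Or.inr ⟨⟨⟨![a, b, c, d], hinj⟩, ?_⟩⟩
      intro i j
      fin_cases i <;> fin_cases j <;>
        simp [cycleGraph_adj, h, h.symm, hab, hab.symm, hbc, hbc.symm, hcd, hcd.symm, hac', hbd',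
          G.adj_comm c a, G.adj_comm d b] <;> decide
    · refine Or.inl ⟨⟨⟨![a, b, c, d], hinj⟩, ?_⟩⟩
      intro i j
      fin_cases i <;> fin_cases j <;> simp [pathGraph_adj, G.adj_comm, *]

/-- If no path on four vertices lacks both of its short chords, then the closed neighborhoods of
adjacent vertices are nested according to degree. -/
lemma adj_of_adj_of_degree_le {V : Type*} [Fintype V] [DecidableEq V] {G : SimpleGraph V}
    [DecidableRel G.Adj]
    (hG : ¬ ∃ a b c d, G.Adj a b ∧ G.Adj b c ∧ G.Adj c d ∧ a ≠ c ∧ b ≠ d ∧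
      ¬ G.Adj a c ∧ ¬ G.Adj b d)
    {x y u : V} (hxy : G.Adj x y) (hdeg : G.degree y ≤ G.degree x) (hyu : G.Adj y u)
    (hux : u ≠ x) : G.Adj x u := by
  by_contra hxu
  have hsub : insert u (insert x ((G.neighborFinset x).erase y)) ⊆ G.neighborFinset y := by
    intro z hz
    simp only [Finset.mem_insert, Finset.mem_erase, mem_neighborFinset] at hz ⊢
    rcases hz with rfl | rfl | ⟨hzy, hxz⟩
    · exact hyu
    · exact hxy.symm
    · by_contra hyz
      exact hG ⟨u, y, x, z, hyu.symm, hxy.symm, hxz, hux, hzy.symm,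
        fun h => hxu h.symm, hyz⟩
  have hcard := Finset.card_le_card hsub
  rw [Finset.card_insert_of_notMem (by simp [hux, hxu]),
    Finset.card_insert_of_notMem (by simp),
    Finset.card_erase_of_mem (by simpa using hxy)] at hcard
  simp only [card_neighborFinset_eq_degree] at hcard
  omega

lemma IsUCO.not_exists_path {V : Type*} {n : ℕ} {G : SimpleGraph V} {v : Fin n ≃ V}
    (h : IsUCO G v) :
    ¬ ∃ a b c d, G.Adj a b ∧ G.Adj b c ∧ G.Adj c d ∧ a ≠ c ∧ b ≠ d ∧
      ¬ G.Adj a c ∧ ¬ G.Adj b d := by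
  rintro ⟨a, b, c, d, hab, hbc, hcd, hac, hbd, hac', hbd'⟩
  obtain ⟨a, rfl⟩ := v.surjective a
  obtain ⟨b, rfl⟩ := v.surjective b
  obtain ⟨c, rfl⟩ := v.surjective c
  obtain ⟨d, rfl⟩ := v.surjective d
  rw [v.injective.ne_iff] at hac hbd
  have adj_of_path (i j k : Fin n) (hij : i ≤ j) (hik : i < k) (h₁ : G.Adj (v i) (v j))
      (h₂ : G.Adj (v j) (v k)) : G.Adj (v i) (v k) := by
    refine h i k hik (Reachable.trans (v := ⟨v j, j, hij, rfl⟩) ?_ ?_)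
    · exact Adj.reachable (G := G.induce {x | ∃ k, i ≤ k ∧ v k = x}) h₁
    · exact Adj.reachable (G := G.induce {x | ∃ k, i ≤ k ∧ v k = x}) h₂
  have hac₁ : b < a ∨ c < a := by
    by_contra! hlt
    exact hac' (adj_of_path a b c hlt.1 (lt_of_le_of_ne hlt.2 hac) hab hbc)
  have hac₂ : b < c ∨ a < c := by
    by_contra! hlt
    exact hac' (adj_of_path c b a hlt.1 (lt_of_le_of_ne hlt.2 hac.symm) hbc.symm hab.symm).symm
  have hbd₁ : c < b ∨ d < b := by
    by_contra! hlt
    exact hbd' (adj_of_path b c d hlt.1 (lt_of_le_of_ne hlt.2 hbd) hbc hcd)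
  have hbd₂ : c < d ∨ b < d := by
    by_contra! hlt
    exact hbd' (adj_of_path d c b hlt.1 (lt_of_le_of_ne hlt.2 hbd.symm) hcd.symm hbc.symm).symm
  omega

lemma isUCO_of_not_exists_path {V : Type*} [Fintype V] [DecidableEq V] {n : ℕ}
    {G : SimpleGraph V} [DecidableRel G.Adj] {v : Fin n ≃ V}
    (hdeg : ∀ i j : Fin n, i ≤ j → G.degree (v j) ≤ G.degree (v i))
    (hG : ¬ ∃ a b c d, G.Adj a b ∧ G.Adj b c ∧ G.Adj c d ∧ a ≠ c ∧ b ≠ d ∧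
      ¬ G.Adj a c ∧ ¬ G.Adj b d) : IsUCO G v := by
  intro i j hij hreach
  have key (y : {x | ∃ k, i ≤ k ∧ v k = x})
      (hy : (G.induce {x | ∃ k, i ≤ k ∧ v k = x}).Reachable ⟨v i, i, le_rfl, rfl⟩ y) :
      y.1 = v i ∨ G.Adj (v i) y.1 := by
    rw [reachable_iff_reflTransGen] at hy
    induction hy with
    | refl => exact Or.inl rfl
    | @tail y z _ hyz ih =>
      have hyz : G.Adj y.1 z.1 := hyz
      obtain ⟨k, hik, hk⟩ := y.2
      rcases ih with ih | ih
      · exact Or.inr (ih ▸ hyz)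
      · exact or_iff_not_imp_left.2 (adj_of_adj_of_degree_le hG ih (hk ▸ hdeg i k hik) hyz)
  exact (key _ hreach).resolve_left fun h => hij.ne' (v.injective h)

/-- For a finite simple graph `G`, any ordering `(v 0, …, v (n-1))` of its vertices by
non-increasing degree is a universal-in-a-component ordering if and only if `G` is
trivially perfect, i.e. `G` has no induced subgraph isomorphic to `P₄` or `C₄`. -/
theorem nonincreasing_degree_isUCO_iff_trivially_perfect {V : Type*} [Fintype V]
    [DecidableEq V] (G : SimpleGraph V) [DecidableRel G.Adj]
    (v : Fin (Fintype.card V) ≃ V)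
    (hdeg : ∀ i j : Fin (Fintype.card V), i ≤ j → G.degree (v j) ≤ G.degree (v i)) :
    IsUCO G v ↔
      ¬ HasInducedSubgraph G (pathGraph 4) ∧ ¬ HasInducedSubgraph G (cycleGraph 4) := by
  rw [← not_or, hasInducedSubgraph_path_or_cycle_four_iff]
  exact ⟨IsUCO.not_exists_path, isUCO_of_not_exists_path hdeg⟩
end

section
/- Let G be a finite simple bipartite graph with bipartition (U, W), i.e., every edge of G has one endpoint in U and one in W. Then U admits a nested neighborhood ordering if and only if W admits a nested neighborhood ordering. -/
open SimpleGraph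

/-- The set `X` admits a nested neighborhood ordering in `G`: there is an enumeration
`(v 1, …, v k)` of `X` with `N(v 1) \ X ⊆ N(v 2) \ X ⊆ … ⊆ N(v k) \ X`. -/
def HasNNO {V : Type*} (G : SimpleGraph V) (X : Set V) : Prop :=
  ∃ l : List V, l.Nodup ∧ {a | a ∈ l} = X ∧
    l.Chain' fun a b => G.neighborSet a \ X ⊆ G.neighborSet b \ X

/-- Over a finite vertex set, `X` admits a nested neighborhood ordering iff the sets
`N(v) \ X` for `v ∈ X` are pairwise comparable. -/
theorem hasNNO_iff_forall_subset_or_subset {V : Type*} [Finite V] (G : SimpleGraph V)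
    (X : Set V) :
    HasNNO G X ↔ ∀ a ∈ X, ∀ b ∈ X,
      G.neighborSet a \ X ⊆ G.neighborSet b \ X ∨ G.neighborSet b \ X ⊆ G.neighborSet a \ X := by
  classical
  constructor
  · rintro ⟨l, -, rfl, hchain⟩ a ha b hb
    let r : V → V → Prop := fun a b =>
      G.neighborSet a \ {a | a ∈ l} ⊆ G.neighborSet b \ {a | a ∈ l}
    have : IsTrans V r := ⟨fun _ _ _ => Set.Subset.trans⟩
    have hpair : l.Pairwise r := List.isChain_iff_pairwise.1 hchain
    have : Std.Symm fun a b => r a b ∨ r b a := ⟨fun _ _ => Or.symm⟩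
    have hpair_or : l.Pairwise fun a b => r a b ∨ r b a := hpair.imp Or.inl
    exact List.Pairwise.forall_of_forall (R := fun a b => r a b ∨ r b a)
      (fun _ _ => Or.inl (Set.Subset.refl _)) hpair_or ha hb
  · intro h
    let r : V → V → Prop := fun a b =>
      (G.neighborSet a \ X).ncard ≤ (G.neighborSet b \ X).ncard
    have : Std.Total r := ⟨fun _ _ => le_total _ _⟩
    have : IsTrans V r := ⟨fun _ _ _ => le_trans⟩
    let s := X.toFinite.toFinset
    refine ⟨s.toList.insertionSort r, ?_, ?_, ?_⟩
    · exact (List.perm_insertionSort r _).nodup_iff.2 s.nodup_toList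
    · ext a
      simp [s, (List.perm_insertionSort r _).mem_iff]
    · refine List.Pairwise.isChain
        ((List.pairwise_insertionSort r s.toList).imp_of_mem fun {a b} ha hb hab => ?_)
      have mem_of_mem {c : V} (hc : c ∈ s.toList.insertionSort r) : c ∈ X := by
        simpa [s, (List.perm_insertionSort r _).mem_iff] using hc
      rcases h a (mem_of_mem ha) b (mem_of_mem hb) with h | h
      · exact h
      · exact (Set.eq_of_subset_of_ncard_le h hab).ge

/-- In a bipartite graph, nestedness of neighborhoods passes from one side to the other. -/
theorem HasNNO.of_bipartite {V : Type*} [Finite V] {G : SimpleGraph V} {U W : Set V}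
    (hdisj : Disjoint U W)
    (hbip : ∀ a b : V, G.Adj a b → (a ∈ U ∧ b ∈ W) ∨ (a ∈ W ∧ b ∈ U))
    (hU : HasNNO G U) : HasNNO G W := by
  rw [hasNNO_iff_forall_subset_or_subset] at hU ⊢
  intro a ha b hb
  by_contra! hab
  obtain ⟨⟨x, ⟨hax, hxW⟩, hbx⟩, ⟨y, ⟨hby, hyW⟩, hay⟩⟩ :=
    And.imp Set.not_subset.1 Set.not_subset.1 hab
  have haU : a ∉ U := hdisj.notMem_of_mem_right ha
  have hbU : b ∉ U := hdisj.notMem_of_mem_right hb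
  have hxU : x ∈ U := by
    rcases hbip a x hax with h | h
    exacts [absurd h.1 haU, h.2]
  have hyU : y ∈ U := by
    rcases hbip b y hby with h | h
    exacts [absurd h.1 hbU, h.2]
  rcases hU x hxU y hyU with h | h
  · exact hay ⟨(h ⟨SimpleGraph.Adj.symm hax, haU⟩).1.symm, hyW⟩
  · exact hbx ⟨(h ⟨SimpleGraph.Adj.symm hby, hbU⟩).1.symm, hxW⟩

/-- Let `G` be a finite simple bipartite graph with bipartition `(U, W)`.  Then `U`
admits a nested neighborhood ordering if and only if `W` admits a nested neighborhood
ordering. -/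
theorem bipartite_nno_side_iff_other_side {V : Type*} [Fintype V] (G : SimpleGraph V)
    (U W : Set V) (hpart : U ∪ W = Set.univ) (hdisj : Disjoint U W)
    (hbip : ∀ a b : V, G.Adj a b → (a ∈ U ∧ b ∈ W) ∨ (a ∈ W ∧ b ∈ U)) :
    HasNNO G U ↔ HasNNO G W := by
  exact ⟨.of_bipartite hdisj hbip,
    .of_bipartite hdisj.symm fun a b hab => (hbip a b hab).symm⟩
end
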